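/- Let d ∈ ℕ, τ ≥ d+1, n ≥ τ⁴, and p ∈ P_τ. Then for every k ∈ B_{n,p}, and for either sign ±, | ½ ( δ_{k,p} ± n^{−1/2} 1_d )ᵀ Σ_p^{−1} ( δ_{k,p} ± n^{−1/2} 1_d ) − ½ δ_{k,p}ᵀ Σ_p^{−1} δ_{k,p} | ≤ 1.05 τ² (d+1)² (log n)^{1/2} / n^{1/2}, where 1_d = (1,…,1)ᵀ ∈ ℝ^d. -/

import Mathlib

open MeasureTheory Matrix Real Finset
open scoped BigOperators ENNReal NNReal

noncomputable section

/-- Extended probability vector: `p` on `Fin d`, together with `p (d+1) = 1 - ∑ p`. -/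
def extP (d : ℕ) (p : Fin d → ℝ) : Fin (d + 1) → ℝ :=
  Fin.snoc p (1 - ∑ i, p i)

/-- Extended coordinate vector: `v` on `Fin d`, together with `v (d+1) = n - ∑ v`. -/
def extV (d n : ℕ) (v : Fin d → ℝ) : Fin (d + 1) → ℝ :=
  Fin.snoc v ((n : ℝ) - ∑ i, v i)

/-- `δ_{y,q} = (y - n q) / √n`. -/
def del (n : ℕ) (q y : ℝ) : ℝ := (y - n * q) / Real.sqrt n

/-- The vector `δ_{v,p}`. -/
def delVec (d n : ℕ) (p v : Fin d → ℝ) : Fin d → ℝ := fun i => del n (p i) (v i)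

/-- The covariance matrix `Σ_p = diag p - p pᵀ`. -/
def covM (d : ℕ) (p : Fin d → ℝ) : Matrix (Fin d) (Fin d) ℝ :=
  Matrix.diagonal p - Matrix.vecMulVec p p

/-- The quadratic form `x ↦ xᵀ Σ_p⁻¹ x`. -/
def quadForm (d : ℕ) (p x : Fin d → ℝ) : ℝ := x ⬝ᵥ ((covM d p)⁻¹ *ᵥ x)

/-- The Gaussian density `φ_{Σ_p}`. -/
def gaussDens (d : ℕ) (p y : Fin d → ℝ) : ℝ :=
  Real.exp (-(1 / 2) * quadForm d p y) /
    Real.sqrt ((2 * Real.pi) ^ d * ∏ i, extP d p i)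

/-- The `Multinomial(n, p)` probability mass function. -/
def multinomialPMF (d n : ℕ) (p : Fin d → ℝ) (k : Fin d → ℕ) : ℝ :=
  if ∑ i, k i ≤ n then
    ((n.factorial : ℝ) / ((∏ i, ((k i).factorial : ℝ)) * ((n - ∑ i, k i).factorial : ℝ))) *
      ((∏ i, p i ^ k i) * (1 - ∑ i, p i) ^ (n - ∑ i, k i))
  else 0

/-- The interior `S_d^o` of the unit simplex. -/
def simplexInt (d : ℕ) : Set (Fin d → ℝ) :=
  {s | (∀ i, s i ∈ Set.Ioo (0 : ℝ) 1) ∧ ∑ i, s i < 1}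

/-- The set `P_τ`. -/
def Ptau (d : ℕ) (τ : ℝ) : Set (Fin d → ℝ) :=
  {s | s ∈ simplexInt d ∧ ∀ i : Fin (d + 1), (extP d s i)⁻¹ ≤ τ}

/-- Cast a vector of naturals to a real vector. -/
def castK (d : ℕ) (k : Fin d → ℕ) : Fin d → ℝ := fun i => (k i : ℝ)

/-- The bulk set `B_{n,p}` (integer vectors). -/
def bulk (d n : ℕ) (τ : ℝ) (p : Fin d → ℝ) : Set (Fin d → ℕ) :=
  {k | (∀ i, 0 < k i) ∧ ∑ i, k i < n ∧
    ∀ i : Fin (d + 1),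
      |del n (extP d p i) (extV d n (castK d k) i) / (Real.sqrt n * extP d p i)| ≤
        τ * Real.sqrt (Real.log n / n)}

/-- The bulk set `B_{n,p}` (real vectors). -/
def bulkReal (d n : ℕ) (τ : ℝ) (p : Fin d → ℝ) : Set (Fin d → ℝ) :=
  {x | ∀ i : Fin (d + 1),
    |del n (extP d p i) (extV d n x i) / (Real.sqrt n * extP d p i)| ≤
      τ * Real.sqrt (Real.log n / n)}

/-- The main term in the local expansion. -/
def mainTerm (d n : ℕ) (p v : Fin d → ℝ) : ℝ :=
  (n : ℝ) ^ (-(1 : ℝ) / 2) * ∑ i : Fin (d + 1),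
    (del n (extP d p i) (extV d n v i) ^ 3 / (6 * extP d p i ^ 2) -
      del n (extP d p i) (extV d n v i) / (2 * extP d p i))

/-- The bound on the remainder `R_{n,p}(k)`. -/
def errBound (d n : ℕ) (τ : ℝ) (p v : Fin d → ℝ) : ℝ :=
  (n : ℝ)⁻¹ * ∑ i : Fin (d + 1),
    (21 * |del n (extP d p i) (extV d n v i)| ^ 4 / extP d p i ^ 3 +
      10 * |del n (extP d p i) (extV d n v i)| ^ 2 / extP d p i ^ 2 + 2 * τ / 3)

/-- The log-ratio of the multinomial pmf over the corresponding normal density. -/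
def logRatio (d n : ℕ) (p : Fin d → ℝ) (k : Fin d → ℕ) : ℝ :=
  Real.log (multinomialPMF d n p k /
    ((n : ℝ) ^ (-(d : ℝ) / 2) * gaussDens d p (delVec d n p (castK d k))))

/-- The law of a `Multinomial(n,p)` random vector, as a measure on `ℝ^d`. -/
def multinomialLaw (d n : ℕ) (p : Fin d → ℝ) : Measure (Fin d → ℝ) :=
  Measure.sum fun k : Fin d → ℕ =>
    ENNReal.ofReal (multinomialPMF d n p k) • Measure.dirac (castK d k)

/-- The law of a `Uniform(-1/2,1/2)^d` random vector. -/
def uniformBoxLaw (d : ℕ) : Measure (Fin d → ℝ) :=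
  volume.restrict (Set.univ.pi fun _ : Fin d => Set.Ioo (-(1 : ℝ) / 2) (1 / 2))

/-- The law of a `Normal_d (n p, n Σ_p)` random vector. -/
def gaussLaw (d n : ℕ) (p : Fin d → ℝ) : Measure (Fin d → ℝ) :=
  volume.withDensity fun y =>
    ENNReal.ofReal ((n : ℝ) ^ (-(d : ℝ) / 2) * gaussDens d p (delVec d n p y))

/-- The regularized lower incomplete gamma function `γ̄(x, a)`. -/
def regGamma (x a : ℝ) : ℝ :=
  (∫ t in (0 : ℝ)..a, t ^ (x - 1) * Real.exp (-t)) / Real.Gamma x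

/-- The explicit form of `Σ_p⁻¹` is a right inverse of `Σ_p`. -/
lemma covM_inv (d : ℕ) (p : Fin d → ℝ) (hp : ∀ i, p i ≠ 0) (hq : 1 - ∑ i, p i ≠ 0) :
    (covM d p)⁻¹ =
      Matrix.diagonal (fun i => (p i)⁻¹) +
        Matrix.vecMulVec (fun _ => 1) (fun _ => (1 - ∑ i, p i)⁻¹) := by
  apply Matrix.inv_eq_right_inv
  ext i j
  have hpj := hp j
  have hdiag : (Matrix.diagonal p * Matrix.diagonal fun i => (p i)⁻¹) = 1 := by
    rw [Matrix.diagonal_mul_diagonal, ← Matrix.diagonal_one]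
    congr 1
    ext i
    exact mul_inv_cancel₀ (hp i)
  rw [covM, sub_mul, mul_add, mul_add, hdiag]
  simp only [Matrix.sub_apply, Matrix.add_apply, Matrix.diagonal_mul, Matrix.mul_diagonal,
    Matrix.vecMulVec_mul_vecMulVec, Matrix.vecMulVec_apply, dotProduct,
    Pi.smul_apply, smul_eq_mul, mul_one, one_mul]
  field_simp
  ring

lemma quadForm_eq (d : ℕ) (p x : Fin d → ℝ) (hp : ∀ i, p i ≠ 0) (hq : 1 - ∑ i, p i ≠ 0) :
    quadForm d p x = ∑ i, x i ^ 2 / p i + (∑ i, x i) ^ 2 / (1 - ∑ i, p i) := by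
  rw [quadForm, covM_inv d p hp hq, Matrix.add_mulVec, dotProduct_add]
  congr 1
  · simp only [dotProduct, Matrix.mulVec_diagonal]
    exact Finset.sum_congr rfl fun i _ => by ring
  · simp only [dotProduct, Matrix.mulVec, Matrix.vecMulVec_apply, one_mul]
    rw [← Finset.sum_mul, ← Finset.mul_sum]
    ring

/-- The increment of the quadratic form under a shift along `(1, …, 1)`. -/
lemma quadForm_add_const_sub (d : ℕ) (p x : Fin d → ℝ) (t : ℝ) (hp : ∀ i, p i ≠ 0)
    (hq : 1 - ∑ i, p i ≠ 0) :
    quadForm d p (fun i => x i + t) - quadForm d p x =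
      2 * t * (∑ i, x i / p i - d * (-(∑ i, x i) / (1 - ∑ i, p i))) +
        t ^ 2 * (∑ i, (p i)⁻¹ + d ^ 2 * (1 - ∑ i, p i)⁻¹) := by
  rw [quadForm_eq d p _ hp hq, quadForm_eq d p _ hp hq]
  have h : ∑ i, (x i + t) ^ 2 / p i =
      ∑ i, x i ^ 2 / p i + 2 * t * ∑ i, x i / p i + t ^ 2 * ∑ i, (p i)⁻¹ := by
    rw [Finset.mul_sum, Finset.mul_sum, ← Finset.sum_add_distrib, ← Finset.sum_add_distrib]
    exact Finset.sum_congr rfl fun i _ => by ring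
  rw [h, Finset.sum_add_distrib, Finset.sum_const, Finset.card_univ, Fintype.card_fin,
    nsmul_eq_mul]
  ring

lemma del_extV_last (d n : ℕ) (p v : Fin d → ℝ) :
    del n (extP d p (Fin.last d)) (extV d n v (Fin.last d)) = -∑ i, delVec d n p v i := by
  simp only [delVec, del, extP, extV, Fin.snoc_last, ← Finset.sum_div, Finset.sum_sub_distrib,
    ← Finset.mul_sum]
  ring

lemma abs_sum_sub_card_mul_le (d : ℕ) (a : Fin d → ℝ) (b M : ℝ) (ha : ∀ i, |a i| ≤ M)
    (hb : |b| ≤ M) : |∑ i, a i - d * b| ≤ 2 * d * M := by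
  have h₁ : |∑ i, a i| ≤ d * M :=
    (Finset.abs_sum_le_sum_abs _ _).trans
      ((Finset.sum_le_sum fun i _ => ha i).trans (by simp))
  have h₂ : |(d : ℝ) * b| ≤ d * M := by
    rw [abs_mul, Nat.abs_cast]
    gcongr
  linarith [abs_sub (∑ i, a i) (d * b)]

/-- In the bulk, the ratios `δ_{k_i,p_i} / p_i` are at most `τ √(log n)`. -/
lemma abs_del_div_le_of_mem_bulk {d n : ℕ} {τ : ℝ} {p : Fin d → ℝ} {k : Fin d → ℕ}
    (hn : 0 < n) (hk : k ∈ bulk d n τ p) (i : Fin (d + 1)) :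
    |del n (extP d p i) (extV d n (castK d k) i) / extP d p i| ≤ τ * √(Real.log n) := by
  have hr : 0 < √(n : ℝ) := Real.sqrt_pos.2 (by exact_mod_cast hn)
  have h := hk.2.2 i
  rw [Real.sqrt_div' _ (Nat.cast_nonneg n), mul_comm (√(n : ℝ)), ← div_div, abs_div,
    abs_of_pos hr, ← mul_div_assoc] at h
  exact (div_le_div_iff_of_pos_right hr).1 h

/-- **Stability of the quadratic form under shifts by `± n^{-1/2} (1, …, 1)ᵀ`.** -/
theorem stmt19 (d : ℕ) (τ : ℝ) (hτ : (d : ℝ) + 1 ≤ τ) (n : ℕ) (hn : τ ^ 4 ≤ (n : ℝ))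
    (p : Fin d → ℝ) (hp : p ∈ Ptau d τ) (k : Fin d → ℕ) (hk : k ∈ bulk d n τ p)
    (s : ℝ) (hs : s = 1 ∨ s = -1) :
    |1 / 2 * ((fun i => delVec d n p (castK d k) i + s / Real.sqrt n) ⬝ᵥ
          ((covM d p)⁻¹ *ᵥ fun i => delVec d n p (castK d k) i + s / Real.sqrt n)) -
        1 / 2 * quadForm d p (delVec d n p (castK d k))| ≤
      1.05 * τ ^ 2 * ((d : ℝ) + 1) ^ 2 * Real.sqrt (Real.log n) / Real.sqrt n := by
  obtain ⟨⟨hp01, hq⟩, hinv⟩ := hp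
  have hp0 : ∀ i, p i ≠ 0 := fun i => (hp01 i).1.ne'
  have hq0 : 1 - ∑ i, p i ≠ 0 := by linarith
  have hd0 : (0 : ℝ) ≤ d := Nat.cast_nonneg d
  have hτ1 : 1 ≤ τ := by linarith
  have hn1 : (1 : ℝ) ≤ n := (one_le_pow₀ hτ1).trans hn
  have hnpos : 0 < n := by exact_mod_cast hn1
  have hr1 : 1 ≤ √(n : ℝ) := Real.one_le_sqrt.2 hn1
  have hr0 : 0 < √(n : ℝ) := by linarith
  have hb := abs_del_div_le_of_mem_bulk hnpos hk
  have hlin := abs_sum_sub_card_mul_le d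
    (fun i => delVec d n p (castK d k) i / p i)
    (-(∑ i, delVec d n p (castK d k) i) / (1 - ∑ i, p i)) (τ * √(Real.log n))
    (fun i => by simpa [extP, extV, delVec] using hb i.castSucc)
    (by
      have h := hb (Fin.last d)
      rw [del_extV_last] at h
      simpa [extP] using h)
  have hquad : |∑ i, (p i)⁻¹ + d ^ 2 * (1 - ∑ i, p i)⁻¹| ≤ τ * (d * (d + 1)) := by
    have h₁ : ∑ i, (p i)⁻¹ ≤ d * τ :=
      (Finset.sum_le_sum fun i _ => by simpa [extP] using hinv i.castSucc).trans (by simp)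
    have h₂ : (1 - ∑ i, p i)⁻¹ ≤ τ := by simpa [extP] using hinv (Fin.last d)
    have h₃ : 0 ≤ ∑ i, (p i)⁻¹ := Finset.sum_nonneg fun i _ => inv_nonneg.2 (hp01 i).1.le
    have h₄ : 0 ≤ (1 - ∑ i, p i)⁻¹ := inv_nonneg.2 (by linarith)
    rw [abs_of_nonneg (by positivity)]
    nlinarith [mul_le_mul_of_nonneg_left h₂ (sq_nonneg (d : ℝ))]
  have hs1 : |s| = 1 := by rcases hs with rfl | rfl <;> simp
  have ht : |s / √(n : ℝ)| = 1 / √(n : ℝ) := by rw [abs_div, hs1, abs_of_pos hr0]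
  have hmain := quadForm_add_const_sub d p (delVec d n p (castK d k)) (s / √(n : ℝ)) hp0 hq0
  rw [← quadForm, ← mul_sub, hmain]
  set A := ∑ i, delVec d n p (castK d k) i / p i -
    d * (-(∑ i, delVec d n p (castK d k) i) / (1 - ∑ i, p i))
  set B := ∑ i, (p i)⁻¹ + d ^ 2 * (1 - ∑ i, p i)⁻¹
  set L := √(Real.log n)
  set r := √(n : ℝ)
  have hL0 : 0 ≤ L := Real.sqrt_nonneg _
  have hbound : |1 / 2 * (2 * (s / r) * A + (s / r) ^ 2 * B)| ≤
      (2 * d * (τ * L) + τ * (d * (d + 1)) / 2) / r := by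
    have e : 1 / 2 * (2 * (s / r) * A + (s / r) ^ 2 * B) =
        (s / r) * A + (s / r) ^ 2 * (B / 2) := by ring
    rw [e]
    refine (abs_add_le _ _).trans ?_
    rw [abs_mul, abs_mul, abs_pow, ht, abs_div, abs_two, add_div]
    have hsq : (1 / r) ^ 2 ≤ 1 / r :=
      pow_le_of_le_one (by positivity) ((div_le_one hr0).2 hr1) two_ne_zero
    have h₁ : 1 / r * |A| ≤ 2 * d * (τ * L) / r := by
      rw [one_div_mul_eq_div]
      gcongr
    have h₂ : (1 / r) ^ 2 * (|B| / 2) ≤ τ * (d * (d + 1)) / 2 / r := by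
      rw [div_eq_mul_one_div (τ * (d * (d + 1)) / 2), mul_comm]
      gcongr
    exact add_le_add h₁ h₂
  refine hbound.trans ((div_le_div_iff_of_pos_right hr0).2 ?_)
  rcases Nat.eq_zero_or_pos d with rfl | hd
  · simp
    positivity
  · have hd1 : (1 : ℝ) ≤ d := by exact_mod_cast hd
    have hτ2 : 2 ≤ τ := by linarith
    have hL1 : 1 ≤ L := by
      refine Real.one_le_sqrt.2 ((Real.le_log_iff_exp_le (by linarith)).2 ?_)
      have h16 : (2 : ℝ) ^ 4 ≤ τ ^ 4 := by gcongr
      linarith [Real.exp_one_lt_d9]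
    have hτL : 0 ≤ τ * L := by positivity
    have h₁ : τ * (d * (d + 1)) ≤ τ * L * (d * (d + 1)) := by
      gcongr
      nlinarith
    have h₂ : 2 * (τ * L * (d + 1) ^ 2) ≤ τ * (τ * L * (d + 1) ^ 2) := by gcongr
    have h₃ : 0 ≤ τ * L * (d : ℝ) ^ 2 := by positivity
    have h₄ : 0 ≤ τ * L * (d : ℝ) := by positivity
    nlinarith
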